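/- arXiv:1901.04959 — 6 statements merged into one kernel-verified Lean document; each statement's English description precedes it below -/
import Mathlib

section
/- Fix n ≥ 1, channel qualities γ : Fin n → ℝ with γ i > 0 for all i, and a power budget P > 0. Suppose φ* > 0 satisfies ∑_i max(1/φ* − 1/(γ i), 0) = P, and define p* i = max(1/φ* − 1/(γ i), 0). Then p* is optimal for the water-filling problem: for every p : Fin n → ℝ with p i ≥ 0 for all i and ∑_i p i ≤ P, one has ∑_i Real.log (1 + γ i * p i) ≤ ∑_i Real.log (1 + γ i * p* i). -/
open Finset

/-- First-order bound for one channel: at the water-filling power, the tangent slope of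
`log (1 + g * x)` is dominated by the water level `φ` on `x ≥ 0`. -/
theorem log_one_add_mul_le_waterfilling {g φ x : ℝ} (hg : 0 < g) (hφ : 0 < φ) (hx : 0 ≤ x) :
    Real.log (1 + g * x) ≤
      Real.log (1 + g * max (1 / φ - 1 / g) 0) + φ * (x - max (1 / φ - 1 / g) 0) := by
  have hpos : 0 < 1 + g * x := by positivity
  rcases le_total g φ with h | h
  · rw [max_eq_right (sub_nonpos.2 (one_div_le_one_div_of_le hg h))]
    have h₁ := Real.log_le_sub_one_of_pos hpos
    have h₂ := mul_le_mul_of_nonneg_right h hx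
    simp only [mul_zero, add_zero, Real.log_one, sub_zero, zero_add]
    linarith
  · rw [max_eq_left (sub_nonneg.2 (one_div_le_one_div_of_le hφ h))]
    have hlevel : 1 + g * (1 / φ - 1 / g) = g / φ := by field_simp; ring
    have hlog := Real.log_le_sub_one_of_pos (div_pos hpos (div_pos hg hφ))
    rw [Real.log_div hpos.ne' (div_pos hg hφ).ne'] at hlog
    have hslope : (1 + g * x) / (g / φ) - 1 = φ * (x - (1 / φ - 1 / g)) := by
      field_simp; ring
    rw [hlevel]
    linarith

/-- Theorem 3 of the paper (water-filling): if `φ* > 0` satisfies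
`∑ i, max (1/φ* − 1/γ i) 0 = P`, then the allocation `p* i = max (1/φ* − 1/γ i) 0`
maximizes `∑ i, log (1 + γ i * p i)` over all feasible allocations. -/
theorem waterfilling_optimal
    (n : ℕ) (hn : 1 ≤ n)
    (γ : Fin n → ℝ) (hγ : ∀ i, 0 < γ i)
    (P : ℝ) (hP : 0 < P)
    (φ : ℝ) (hφ : 0 < φ)
    (heq : ∑ i, max (1 / φ - 1 / γ i) 0 = P) :
    ∀ p : Fin n → ℝ, (∀ i, 0 ≤ p i) → (∑ i, p i ≤ P) →
      ∑ i, Real.log (1 + γ i * p i)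
        ≤ ∑ i, Real.log (1 + γ i * max (1 / φ - 1 / γ i) 0) := by
  intro p hp hsum
  calc ∑ i, Real.log (1 + γ i * p i)
      ≤ ∑ i, (Real.log (1 + γ i * max (1 / φ - 1 / γ i) 0)
          + φ * (p i - max (1 / φ - 1 / γ i) 0)) :=
        sum_le_sum fun i _ => log_one_add_mul_le_waterfilling (hγ i) hφ (hp i)
    _ = ∑ i, Real.log (1 + γ i * max (1 / φ - 1 / γ i) 0) + φ * (∑ i, p i - P) := by
        rw [sum_add_distrib, ← mul_sum, sum_sub_distrib, heq]
    _ ≤ ∑ i, Real.log (1 + γ i * max (1 / φ - 1 / γ i) 0) :=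
        add_le_of_nonpos_right (mul_nonpos_of_nonneg_of_nonpos hφ.le (sub_nonpos.2 hsum))
end

section
/- Let γ > 0 and φ > 0 be real numbers, and set q = max(1/φ − 1/γ, 0). Then for every real x ≥ 0, Real.log (1 + γ*x) − φ*x ≤ Real.log (1 + γ*q) − φ*q. That is, q maximizes the per-coordinate Lagrangian x ↦ log(1 + γx) − φx over the nonnegative reals. -/
/-- The logarithm lies below its tangent line at `b`. -/
theorem Real.log_sub_log_le_sub_div {a b : ℝ} (ha : 0 < a) (hb : 0 < b) :
    Real.log a - Real.log b ≤ (a - b) / b := by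
  have h := Real.log_le_sub_one_of_pos (div_pos ha hb)
  rwa [Real.log_div ha.ne' hb.ne', div_sub_one hb.ne'] at h

/-- Per-coordinate Lagrangian optimality: for `γ > 0` and `φ > 0`, the point
`q = max (1/φ − 1/γ) 0` maximizes `x ↦ log (1 + γ x) − φ x` over `x ≥ 0`. -/
theorem waterfilling_pointwise_lagrangian
    (γ φ : ℝ) (hγ : 0 < γ) (hφ : 0 < φ) :
    ∀ x : ℝ, 0 ≤ x →
      Real.log (1 + γ * x) - φ * x
        ≤ Real.log (1 + γ * max (1 / φ - 1 / γ) 0)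
            - φ * max (1 / φ - 1 / γ) 0 := by
  intro x hx
  have hx' : 0 < 1 + γ * x := by positivity
  rcases le_total (1 / φ - 1 / γ) 0 with h | h
  · have hle : γ ≤ φ := (one_div_le_one_div hφ hγ).mp (sub_nonpos.mp h)
    have hlog := Real.log_le_sub_one_of_pos hx'
    rw [max_eq_right h, mul_zero, mul_zero, add_zero, Real.log_one]
    linarith [mul_le_mul_of_nonneg_right hle hx]
  · rw [max_eq_left h]
    have hb : 1 + γ * (1 / φ - 1 / γ) = γ / φ := by field_simp; ring
    have hlog := Real.log_sub_log_le_sub_div hx' (div_pos hγ hφ)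
    have hslope : (1 + γ * x - γ / φ) / (γ / φ) = φ * x - φ * (1 / φ - 1 / γ) := by
      field_simp; ring
    rw [hb]
    linarith
end

section
/- Fix n ≥ 1, γ : Fin n → ℝ with γ i > 0 for all i, and P > 0. Then there exists φ > 0 such that ∑_i max(1/φ − 1/(γ i), 0) = P. -/
/-- If all thresholds `c i` are nonnegative, then every positive budget `P` is attained by the
piecewise linear map `w ↦ ∑ i, max (w - c i) 0` at some positive level `w`. -/
theorem exists_pos_sum_max_sub_eq {ι : Type*} [Fintype ι] [Nonempty ι]
    (c : ι → ℝ) (hc : ∀ i, 0 ≤ c i) {P : ℝ} (hP : 0 < P) :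
    ∃ w : ℝ, 0 < w ∧ ∑ i, max (w - c i) 0 = P := by
  obtain ⟨j⟩ := ‹Nonempty ι›
  have hzero : ∑ i, max (0 - c i) 0 = 0 :=
    Finset.sum_eq_zero fun i _ => max_eq_right (by linarith [hc i])
  have hlarge : P ≤ ∑ i, max (P + c j - c i) 0 :=
    calc P ≤ max (P + c j - c j) 0 := by simp
      _ ≤ ∑ i, max (P + c j - c i) 0 :=
        Finset.single_le_sum (f := fun i => max (P + c j - c i) 0)
          (fun i _ => le_max_right _ _) (Finset.mem_univ j)
  have hcont : Continuous fun w : ℝ => ∑ i, max (w - c i) 0 := by fun_prop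
  obtain ⟨w, hw, hwP⟩ := intermediate_value_Icc (add_nonneg hP.le (hc j)) hcont.continuousOn
    ⟨hzero.trans_le hP.le, hlarge⟩
  refine ⟨w, hw.1.lt_of_ne ?_, hwP⟩
  rintro rfl
  exact hP.ne (hzero.symm.trans hwP)

/-- Existence of the optimal water level: for `γ i > 0` and `P > 0` there is a
`φ > 0` with `∑ i, max (1/φ − 1/γ i) 0 = P`. -/
theorem waterlevel_exists
    (n : ℕ) (hn : 1 ≤ n)
    (γ : Fin n → ℝ) (hγ : ∀ i, 0 < γ i)
    (P : ℝ) (hP : 0 < P) :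
    ∃ φ : ℝ, 0 < φ ∧ ∑ i, max (1 / φ - 1 / γ i) 0 = P := by
  have : Nonempty (Fin n) := ⟨⟨0, hn⟩⟩
  obtain ⟨w, hw, hwP⟩ :=
    exists_pos_sum_max_sub_eq (fun i => 1 / γ i) (fun i => (one_div_pos.2 (hγ i)).le) hP
  exact ⟨1 / w, one_div_pos.2 hw, by rwa [one_div_one_div]⟩
end

section
/- Fix n ≥ 1, γ : Fin n → ℝ with γ i > 0 for all i, and P > 0. If φ₁ > 0 and φ₂ > 0 both satisfy ∑_i max(1/φ − 1/(γ i), 0) = P, then φ₁ = φ₂. That is, the optimal water level φ* of Theorem 3 is unique. -/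
/-- The total power poured up to level `a` over floors `c` strictly increases with the level once
it is positive. -/
theorem sum_max_sub_zero_lt_of_lt {ι : Type*} (s : Finset ι) (c : ι → ℝ) {a b : ℝ} (hab : a < b)
    (ha : 0 < ∑ i ∈ s, max (a - c i) 0) :
    ∑ i ∈ s, max (a - c i) 0 < ∑ i ∈ s, max (b - c i) 0 := by
  obtain ⟨j, hj, hpos⟩ := Finset.exists_lt_of_sum_lt (f := fun _ => (0 : ℝ)) (by simpa using ha)
  have hj' : 0 < a - c j := by simpa using hpos
  refine Finset.sum_lt_sum (fun i _ => by gcongr) ⟨j, hj, ?_⟩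
  rw [max_eq_left hj'.le]
  exact lt_max_of_lt_left (by linarith)

/-- Uniqueness of the optimal water level `φ*` of Theorem 3: two positive water
levels solving `∑ i, max (1/φ − 1/γ i) 0 = P` coincide. -/
theorem waterlevel_unique
    (n : ℕ) (hn : 1 ≤ n)
    (γ : Fin n → ℝ) (hγ : ∀ i, 0 < γ i)
    (P : ℝ) (hP : 0 < P)
    (φ₁ φ₂ : ℝ) (hφ₁ : 0 < φ₁) (hφ₂ : 0 < φ₂)
    (h₁ : ∑ i, max (1 / φ₁ - 1 / γ i) 0 = P)
    (h₂ : ∑ i, max (1 / φ₂ - 1 / γ i) 0 = P) :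
    φ₁ = φ₂ := by
  rcases lt_trichotomy φ₁ φ₂ with h | h | h
  · have := sum_max_sub_zero_lt_of_lt Finset.univ (fun i => 1 / γ i)
      (one_div_lt_one_div_of_lt hφ₁ h) (h₂ ▸ hP)
    linarith
  · exact h
  · have := sum_max_sub_zero_lt_of_lt Finset.univ (fun i => 1 / γ i)
      (one_div_lt_one_div_of_lt hφ₂ h) (h₁ ▸ hP)
    linarith
end

section
/- Fix n ≥ 1 and γ : Fin n → ℝ with γ (0) ≥ γ (1) ≥ … ≥ γ (n−1) > 0 (γ sorted in descending order), and P > 0. Let 1 ≤ m ≤ n and define the water level φ by 1/φ = (P + ∑_{i < m} 1/(γ i)) / m. Suppose 1/φ > 1/(γ (m−1)) and, if m < n, suppose 1/φ ≤ 1/(γ m). Then φ > 0 and ∑_{i < n} max(1/φ − 1/(γ i), 0) = P; moreover max(1/φ − 1/(γ i), 0) = 1/φ − 1/(γ i) for i < m and max(1/φ − 1/(γ i), 0) = 0 for m ≤ i < n. -/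
open Finset

/-- Correctness of the water-level construction of Algorithm 3: with `γ` sorted
in descending order, `1 ≤ m ≤ n`, and `1/φ = (P + ∑_{i<m} 1/γ i)/m` satisfying
`1/φ > 1/γ (m−1)` and (if `m < n`) `1/φ ≤ 1/γ m`, the level `φ` is positive and
solves `∑ i, max (1/φ − 1/γ i) 0 = P`, with exactly the first `m` links
receiving positive power. -/
theorem waterlevel_construction_correct
    (n : ℕ) (hn : 1 ≤ n)
    (γ : Fin n → ℝ) (hpos : ∀ i, 0 < γ i)
    (hsort : ∀ i j : Fin n, i ≤ j → γ j ≤ γ i)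
    (P : ℝ) (hP : 0 < P)
    (m : ℕ) (hm1 : 1 ≤ m) (hmn : m ≤ n)
    (φ : ℝ)
    (hφdef : 1 / φ =
      (P + ∑ i ∈ Finset.univ.filter (fun i : Fin n => (i : ℕ) < m), 1 / γ i) / m)
    (h1 : 1 / φ > 1 / γ ⟨m - 1, by omega⟩)
    (h2 : ∀ h : m < n, 1 / φ ≤ 1 / γ ⟨m, h⟩) :
    0 < φ ∧
    (∑ i, max (1 / φ - 1 / γ i) 0 = P) ∧
    (∀ i : Fin n, (i : ℕ) < m → max (1 / φ - 1 / γ i) 0 = 1 / φ - 1 / γ i) ∧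
    (∀ i : Fin n, m ≤ (i : ℕ) → max (1 / φ - 1 / γ i) 0 = 0) := by
  have hmono : ∀ i j : Fin n, i ≤ j → 1 / γ i ≤ 1 / γ j := fun i j hij =>
    one_div_le_one_div_of_le (hpos j) (hsort i j hij)
  have hactive : ∀ i : Fin n, (i : ℕ) < m →
      max (1 / φ - 1 / γ i) 0 = 1 / φ - 1 / γ i := by
    intro i hi
    have h := hmono i ⟨m - 1, by omega⟩ (Fin.mk_le_mk.2 (by omega))
    exact max_eq_left (by linarith)
  have hinactive : ∀ i : Fin n, m ≤ (i : ℕ) → max (1 / φ - 1 / γ i) 0 = 0 := by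
    intro i hi
    have hlt : m < n := hi.trans_lt i.isLt
    have h := hmono ⟨m, hlt⟩ i (Fin.mk_le_mk.2 hi)
    exact max_eq_right (by linarith [h2 hlt])
  refine ⟨one_div_pos.1 ((one_div_pos.2 (hpos _)).trans h1), ?_, hactive, hinactive⟩
  have hcard : (Finset.univ.filter (fun i : Fin n => (i : ℕ) < m)).card = m := by
    simp [Fin.card_filter_val_lt, hmn]
  have hm0 : (m : ℝ) ≠ 0 := Nat.cast_ne_zero.2 (by omega)
  have hlevel := (eq_div_iff hm0).1 hφdef
  calc ∑ i, max (1 / φ - 1 / γ i) 0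
      = ∑ i ∈ Finset.univ.filter (fun i : Fin n => (i : ℕ) < m),
          max (1 / φ - 1 / γ i) 0 := by
        refine (Finset.sum_subset (Finset.filter_subset _ _) fun i _ hi => ?_).symm
        exact hinactive i (by simpa using hi)
    _ = ∑ i ∈ Finset.univ.filter (fun i : Fin n => (i : ℕ) < m), (1 / φ - 1 / γ i) :=
        Finset.sum_congr rfl fun i hi => hactive i (Finset.mem_filter.1 hi).2
    _ = P := by
        rw [Finset.sum_sub_distrib, Finset.sum_const, hcard, nsmul_eq_mul]
        linarith
end

section
/- Fix n ≥ 1, γ : Fin n → ℝ with γ i > 0 for all i, P > 0, and φ* > 0 with ∑_i max(1/φ* − 1/(γ i), 0) = P; set p* i = max(1/φ* − 1/(γ i), 0). Then for every p : Fin n → ℝ with p i ≥ 0 for all i, ∑_i Real.log (1 + γ i * p i) − φ* * (∑_i p i) ≤ ∑_i Real.log (1 + γ i * p* i) − φ* * (∑_i p* i). That is, the water-filling allocation maximizes the Lagrangian over all nonnegative allocations (not only feasible ones). -/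
/-- The water-filling level maximizes the single-link Lagrangian
`x ↦ log (1 + g * x) − φ * x` over `x ≥ 0`. -/
theorem log_one_add_mul_sub_le_waterfilling {g φ x : ℝ} (hg : 0 < g) (hφ : 0 < φ) (hx : 0 ≤ x) :
    Real.log (1 + g * x) - φ * x
      ≤ Real.log (1 + g * max (1 / φ - 1 / g) 0) - φ * max (1 / φ - 1 / g) 0 := by
  have hpos : 0 < 1 + g * x := by positivity
  rcases le_total φ g with h | h
  · rw [max_eq_left (sub_nonneg.2 (one_div_le_one_div_of_le hφ h))]
    have hlevel : 1 + g * (1 / φ - 1 / g) = g / φ := by field_simp; ring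
    have hlog := Real.log_le_sub_one_of_pos (div_pos hpos (div_pos hg hφ))
    rw [Real.log_div hpos.ne' (div_pos hg hφ).ne'] at hlog
    have hlin : (1 + g * x) / (g / φ) - 1 = φ * x - φ * (1 / φ - 1 / g) := by field_simp; ring
    rw [hlevel]
    linarith
  · rw [max_eq_right (sub_nonpos.2 (one_div_le_one_div_of_le hg h))]
    have hlog := Real.log_le_sub_one_of_pos hpos
    have hmul := mul_le_mul_of_nonneg_right h hx
    simp only [mul_zero, add_zero, Real.log_one, sub_zero]
    linarith

/-- Aggregated Lagrangian optimality (KKT / weak-duality step of Theorem 3):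
the water-filling allocation `p* i = max (1/φ* − 1/γ i) 0` maximizes
`p ↦ ∑ i, log (1 + γ i * p i) − φ* * ∑ i, p i` over all nonnegative
allocations. -/
theorem waterfilling_lagrangian_optimal
    (n : ℕ) (hn : 1 ≤ n)
    (γ : Fin n → ℝ) (hγ : ∀ i, 0 < γ i)
    (P : ℝ) (hP : 0 < P)
    (φ : ℝ) (hφ : 0 < φ)
    (heq : ∑ i, max (1 / φ - 1 / γ i) 0 = P) :
    ∀ p : Fin n → ℝ, (∀ i, 0 ≤ p i) →
      ∑ i, Real.log (1 + γ i * p i) - φ * (∑ i, p i)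
        ≤ ∑ i, Real.log (1 + γ i * max (1 / φ - 1 / γ i) 0)
            - φ * (∑ i, max (1 / φ - 1 / γ i) 0) := by
  intro p hp
  simp only [Finset.mul_sum, ← Finset.sum_sub_distrib]
  exact Finset.sum_le_sum fun i _ => log_one_add_mul_sub_le_waterfilling (hγ i) hφ (hp i)
end
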